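/- Let G=(V,E) be a finite simple undirected graph with preferences as described, assume P≠∅, and let x∈P. Let e={v,w} be an edge in E⁺. Then W_x(v) ∼_v e if and only if B_x(w) ∼_w e. -/

import Mathlib

/-!
Common setup: a finite simple undirected graph `G = (V, E)` where edges are
elements of `Sym2 V`, together with, for each vertex `v`, a complete and
transitive preference relation `pref v` on `E(v) ∪ {∅}` (the unmatched
option `∅` is encoded as `none : Option (Sym2 V)`), where every incident
edge is strictly preferred to `∅`.
-/

/-- A roommates instance: a finite simple graph with preferences. -/
structure RSetup (V : Type*) [Fintype V] [DecidableEq V] where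
  /-- the edge set -/
  E : Finset (Sym2 V)
  /-- the graph is simple: no loops -/
  not_diag : ∀ e ∈ E, ¬ e.IsDiag
  /-- the preference relation `≿ᵥ` of each vertex, on `E(v) ∪ {∅}` -/
  pref : V → Option (Sym2 V) → Option (Sym2 V) → Prop
  /-- completeness of `≿ᵥ` on `E(v) ∪ {∅}` -/
  pref_total : ∀ v : V, ∀ a b : Option (Sym2 V),
    (∀ e, a = some e → e ∈ E ∧ v ∈ e) → (∀ e, b = some e → e ∈ E ∧ v ∈ e) →
    pref v a b ∨ pref v b a
  /-- transitivity of `≿ᵥ` on `E(v) ∪ {∅}` -/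
  pref_trans : ∀ v : V, ∀ a b c : Option (Sym2 V),
    (∀ e, a = some e → e ∈ E ∧ v ∈ e) → (∀ e, b = some e → e ∈ E ∧ v ∈ e) →
    (∀ e, c = some e → e ∈ E ∧ v ∈ e) →
    pref v a b → pref v b c → pref v a c
  /-- every incident edge is strictly preferred to being unmatched -/
  pref_none : ∀ v : V, ∀ e ∈ E, v ∈ e →
    pref v (some e) none ∧ ¬ pref v none (some e)

namespace RSetup

variable {V : Type*} [Fintype V] [DecidableEq V] (S : RSetup V)

/-- `a ≻ᵥ b` : strict preference. -/
def SPref (v : V) (a b : Option (Sym2 V)) : Prop :=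
  S.pref v a b ∧ ¬ S.pref v b a

/-- `a ∼ᵥ b` : indifference. -/
def IPref (v : V) (a b : Option (Sym2 V)) : Prop :=
  S.pref v a b ∧ S.pref v b a

/-- `F(v)` : the set of edges in `F` incident to `v`. -/
def inc (F : Finset (Sym2 V)) (v : V) : Finset (Sym2 V) :=
  F.filter (fun e => v ∈ e)

/-- a matching in `G` -/
def IsMatching (μ : Finset (Sym2 V)) : Prop :=
  μ ⊆ S.E ∧ ∀ v : V, (inc μ v).card ≤ 1

/-- `μ(v)` : the edge of `μ` incident to `v` (or `none`). -/
noncomputable def matchOf (μ : Finset (Sym2 V)) (v : V) : Option (Sym2 V) :=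
  (inc μ v).toList.head?

/-- `e` blocks the matching `μ`. -/
def Blocks (μ : Finset (Sym2 V)) (e : Sym2 V) : Prop :=
  e ∈ S.E ∧ e ∉ μ ∧ (∀ v ∈ e, S.pref v (some e) (matchOf μ v)) ∧
    (∃ v ∈ e, S.SPref v (some e) (matchOf μ v))

/-- a strongly stable matching in `G` -/
def StronglyStable (μ : Finset (Sym2 V)) : Prop :=
  S.IsMatching μ ∧ ∀ e : Sym2 V, ¬ S.Blocks μ e

/-- `x(W) = ∑_{e ∈ W} x(e)` -/
def xS (x : Sym2 V → ℝ) (W : Finset (Sym2 V)) : ℝ := ∑ e ∈ W, x e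

/-- `x ∈ ℝ₊^E`, encoded as a nonnegative function on `Sym2 V` vanishing
outside `E`. -/
def IsVec (x : Sym2 V → ℝ) : Prop :=
  (∀ e, 0 ≤ x e) ∧ ∀ e ∉ S.E, x e = 0

open Classical in
/-- `E[∼ᵥ e] = {f ∈ E(v) : f ∼ᵥ e}` -/
noncomputable def simSet (v : V) (e : Sym2 V) : Finset (Sym2 V) :=
  (inc S.E v).filter (fun f => S.IPref v (some f) (some e))

open Classical in
/-- `E[≻ᵥ e] = {f ∈ E(v) : f ≻ᵥ e}` -/
noncomputable def succSet (v : V) (e : Sym2 V) : Finset (Sym2 V) :=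
  (inc S.E v).filter (fun f => S.SPref v (some f) (some e))

open Classical in
/-- `E⟨X⟩ = {e ∈ E : e ⊆ X}` -/
noncomputable def esub (X : Finset V) : Finset (Sym2 V) :=
  S.E.filter (fun e => ∀ u ∈ e, u ∈ X)

/-- constraint (1): `x(E(v)) ≤ 1` for every vertex `v` -/
def C1 (x : Sym2 V → ℝ) : Prop := ∀ v : V, xS x (inc S.E v) ≤ 1

/-- constraint (2): `x(E[∼ᵥ e]) + ∑_{w ∈ e} x(E[≻_w e]) ≥ 1`
for every edge `e ∈ E` and `v ∈ e` -/
def C2 (x : Sym2 V → ℝ) : Prop := ∀ v w : V, s(v, w) ∈ S.E →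
  xS x (S.simSet v s(v, w)) +
    (xS x (S.succSet v s(v, w)) + xS x (S.succSet w s(v, w))) ≥ 1

/-- constraint (3): `x(E⟨X⟩) ≤ ⌊|X|/2⌋` for every odd `X ⊆ V` -/
def C3 (x : Sym2 V → ℝ) : Prop := ∀ X : Finset V, Odd X.card →
  xS x (S.esub X) ≤ ((X.card / 2 : ℕ) : ℝ)

/-- membership in the polytope `P` -/
def memP (x : Sym2 V → ℝ) : Prop := S.IsVec x ∧ S.C1 x ∧ S.C2 x ∧ S.C3 x

/-- the characteristic vector `χ_μ` of a set of edges -/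
def chi (μ : Finset (Sym2 V)) : Sym2 V → ℝ := fun e => if e ∈ μ then 1 else 0

open Classical in
/-- `E_x = {e ∈ E : x(e) > 0}` -/
noncomputable def supp (x : Sym2 V → ℝ) : Finset (Sym2 V) :=
  S.E.filter (fun e => 0 < x e)

/-- `V₁` : the set of vertices `v` with `x(E(v)) > 0` for some `x ∈ P` -/
def V1 : Set V := {v : V | ∃ x : Sym2 V → ℝ, S.memP x ∧ 0 < xS x (inc S.E v)}

open Classical in
/-- `B_x(v)` : the best edges in `E_x(v)` for `v` -/
noncomputable def Bset (x : Sym2 V → ℝ) (v : V) : Finset (Sym2 V) :=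
  (inc (S.supp x) v).filter
    (fun e => ∀ f ∈ inc (S.supp x) v, S.pref v (some e) (some f))

open Classical in
/-- `W_x(v)` : the worst edges in `E_x(v)` for `v` -/
noncomputable def Wset (x : Sym2 V → ℝ) (v : V) : Finset (Sym2 V) :=
  (inc (S.supp x) v).filter
    (fun e => ∀ f ∈ inc (S.supp x) v, S.pref v (some f) (some e))

/-- a nonempty `F ⊆ E(v)` is flat if `v` is indifferent among its members -/
def Flat (v : V) (F : Finset (Sym2 V)) : Prop :=
  F.Nonempty ∧ ∀ e ∈ F, ∀ f ∈ F, S.IPref v (some e) (some f)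

open Classical in
/-- `T_x` : edges `e ∈ E⟨V₁⟩` such that, for each `v ∈ e`, either
`e ∈ B_x(v) ∪ W_x(v)` or `B_x(v) ≻ᵥ e ≻ᵥ W_x(v)`. -/
noncomputable def Tset (x : Sym2 V → ℝ) : Finset (Sym2 V) :=
  (S.E.filter (fun e => ∀ u ∈ e, u ∈ S.V1)).filter (fun e => ∀ v ∈ e,
    (e ∈ S.Bset x v ∪ S.Wset x v) ∨
      ((∀ f ∈ S.Bset x v, S.SPref v (some f) (some e)) ∧
        (∀ f ∈ S.Wset x v, S.SPref v (some e) (some f))))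

/-- membership in `P(F) = {x ∈ P : x(e) = 0 for all e ∈ E \ F}` -/
def memPF (F : Finset (Sym2 V)) (x : Sym2 V → ℝ) : Prop :=
  S.memP x ∧ ∀ e ∈ S.E, e ∉ F → x e = 0

open Classical in
/-- `E⁺ = {e ∈ E : e ∈ E_z for some z ∈ P}` -/
noncomputable def Eplus : Finset (Sym2 V) :=
  S.E.filter (fun e => ∃ z : Sym2 V → ℝ, S.memP z ∧ 0 < z e)

open Classical in
/-- `P'` : given `x ∈ P` and a strongly stable matching `σ`, the set of
vertices `v ∈ V₁` with `W_x(v) ≻ᵥ σ(v)`, or with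
`B_x(v) ≻ᵥ W_x(v)` and `W_x(v) ∼ᵥ σ(v)`. -/
def Pset (x : Sym2 V → ℝ) (σ : Finset (Sym2 V)) : Set V :=
  {v : V | v ∈ S.V1 ∧
    ((∀ f ∈ S.Wset x v, S.SPref v (some f) (matchOf σ v)) ∨
      ((∀ f ∈ S.Bset x v, ∀ g ∈ S.Wset x v, S.SPref v (some f) (some g)) ∧
        (∀ f ∈ S.Wset x v, S.IPref v (some f) (matchOf σ v))))}

/-- `Q'` : given `x ∈ P` and a strongly stable matching `σ`, the set of
vertices `v ∈ V₁` with `σ(v) ≻ᵥ B_x(v)`, or with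
`B_x(v) ≻ᵥ W_x(v)` and `B_x(v) ∼ᵥ σ(v)`. -/
def Qset (x : Sym2 V → ℝ) (σ : Finset (Sym2 V)) : Set V :=
  {v : V | v ∈ S.V1 ∧
    ((∀ f ∈ S.Bset x v, S.SPref v (matchOf σ v) (some f)) ∨
      ((∀ f ∈ S.Bset x v, ∀ g ∈ S.Wset x v, S.SPref v (some f) (some g)) ∧
        (∀ f ∈ S.Bset x v, S.IPref v (some f) (matchOf σ v))))}

/-- `R'` : given `x ∈ P` and a strongly stable matching `σ`, the set of
vertices `v ∈ V₁` such that `E_x(v)` is flat and `E_x(v) ∼ᵥ σ(v)`. -/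
def Rset (x : Sym2 V → ℝ) (σ : Finset (Sym2 V)) : Set V :=
  {v : V | v ∈ S.V1 ∧ S.Flat v (inc (S.supp x) v) ∧
    ∀ f ∈ inc (S.supp x) v, S.IPref v (some f) (matchOf σ v)}

end RSetup

namespace RSetup

/-- A total transitive relation on a nonempty finite set has a greatest element. -/
theorem exists_forall_rel_of_total {α : Type*} (r : α → α → Prop) (s : Finset α)
    (hs : s.Nonempty) (total : ∀ a ∈ s, ∀ b ∈ s, r a b ∨ r b a)
    (trans : ∀ a ∈ s, ∀ b ∈ s, ∀ c ∈ s, r a b → r b c → r a c) :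
    ∃ m ∈ s, ∀ a ∈ s, r m a := by
  classical
  induction hs using Finset.Nonempty.cons_induction with
  | singleton a =>
    refine ⟨a, by simp, fun b hb => ?_⟩
    rw [Finset.mem_singleton] at hb
    subst hb
    simpa using total b (by simp) b (by simp)
  | cons a s ha hs ih =>
    obtain ⟨m, hm, hmax⟩ := ih
      (fun b hb c hc => total b (Finset.mem_cons_of_mem hb) c (Finset.mem_cons_of_mem hc))
      (fun b hb c hc d hd => trans b (Finset.mem_cons_of_mem hb) c (Finset.mem_cons_of_mem hc)
        d (Finset.mem_cons_of_mem hd))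
    have hm' := Finset.mem_cons_of_mem (hb := ha) hm
    have ha' := Finset.mem_cons_self a s (h := ha)
    rcases total a ha' m hm' with h | h
    · refine ⟨a, ha', fun b hb => ?_⟩
      rcases Finset.mem_cons.1 hb with rfl | hb'
      · simpa using total b ha' b ha'
      · exact trans a ha' m hm' b hb h (hmax b hb')
    · refine ⟨m, hm', fun b hb => ?_⟩
      rcases Finset.mem_cons.1 hb with rfl | hb'
      · exact h
      · exact hmax b hb'

theorem mem_inc {V : Type*} [DecidableEq V] {F : Finset (Sym2 V)} {v : V} {e : Sym2 V} :
    e ∈ inc F v ↔ e ∈ F ∧ v ∈ e := by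
  simp [inc]

variable {V : Type*} [Fintype V] [DecidableEq V] {S : RSetup V}

theorem pref_total_of_mem {v : V} {e f : Sym2 V} (he : e ∈ inc S.E v) (hf : f ∈ inc S.E v) :
    S.pref v (some e) (some f) ∨ S.pref v (some f) (some e) := by
  rw [mem_inc] at he hf
  exact S.pref_total v _ _ (by rintro _ ⟨⟩; exact he) (by rintro _ ⟨⟩; exact hf)

theorem pref_trans_of_mem {v : V} {e f g : Sym2 V} (he : e ∈ inc S.E v) (hf : f ∈ inc S.E v)
    (hg : g ∈ inc S.E v) (hef : S.pref v (some e) (some f)) (hfg : S.pref v (some f) (some g)) :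
    S.pref v (some e) (some g) := by
  rw [mem_inc] at he hf hg
  exact S.pref_trans v _ _ _ (by rintro _ ⟨⟩; exact he) (by rintro _ ⟨⟩; exact hf)
    (by rintro _ ⟨⟩; exact hg) hef hfg

theorem mem_inc_supp {x : Sym2 V → ℝ} {v : V} {e : Sym2 V} :
    e ∈ inc (S.supp x) v ↔ e ∈ inc S.E v ∧ 0 < x e := by
  simp only [mem_inc, supp, Finset.mem_filter]
  tauto

theorem mem_Wset {x : Sym2 V → ℝ} {v : V} {e : Sym2 V} :
    e ∈ S.Wset x v ↔ e ∈ inc (S.supp x) v ∧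
      ∀ f ∈ inc (S.supp x) v, S.pref v (some f) (some e) := by
  simp [Wset]

theorem mem_Bset {x : Sym2 V → ℝ} {v : V} {e : Sym2 V} :
    e ∈ S.Bset x v ↔ e ∈ inc (S.supp x) v ∧
      ∀ f ∈ inc (S.supp x) v, S.pref v (some e) (some f) := by
  simp [Bset]

theorem mem_Eplus {e : Sym2 V} :
    e ∈ S.Eplus ↔ e ∈ S.E ∧ ∃ z : Sym2 V → ℝ, S.memP z ∧ 0 < z e := by
  simp [Eplus]

variable (S) in
open Classical in
/-- The comparison weight of `f` against `e` at `v`: `1` if `f ≻ᵥ e`, `1/2` if `f ∼ᵥ e`,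
and `0` otherwise. -/
noncomputable def prefWeight (v : V) (f e : Sym2 V) : ℝ :=
  (if S.SPref v (some f) (some e) then 1 else 0) +
    (if S.IPref v (some f) (some e) then 1 / 2 else 0)

theorem prefWeight_add_swap {v : V} {e f : Sym2 V} (he : e ∈ inc S.E v) (hf : f ∈ inc S.E v) :
    S.prefWeight v f e + S.prefWeight v e f = 1 := by
  have h := pref_total_of_mem he hf
  by_cases h₁ : S.pref v (some e) (some f) <;> by_cases h₂ : S.pref v (some f) (some e)
  · simp [prefWeight, SPref, IPref, h₁, h₂]; norm_num
  · simp [prefWeight, SPref, IPref, h₁, h₂]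
  · simp [prefWeight, SPref, IPref, h₁, h₂]
  · tauto

theorem sum_prefWeight (x : Sym2 V → ℝ) (v : V) (e : Sym2 V) :
    ∑ f ∈ inc S.E v, x f * S.prefWeight v f e =
      xS x (S.succSet v e) + xS x (S.simSet v e) / 2 := by
  classical
  simp only [xS, succSet, simSet, Finset.sum_filter, Finset.sum_div, prefWeight,
    ← Finset.sum_add_distrib]
  refine Finset.sum_congr rfl fun f _ => ?_
  split_ifs <;> ring

variable (S) in
/-- The total comparison weight of `x` against `e`, summed over the end vertices of `e`. -/
noncomputable def edgeWeight (x : Sym2 V → ℝ) (e : Sym2 V) : ℝ :=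
  ∑ v with v ∈ e, ∑ f ∈ inc S.E v, x f * S.prefWeight v f e

theorem sum_ends {v w : V} (he : s(v, w) ∈ S.E) (g : V → ℝ) :
    ∑ u with u ∈ s(v, w), g u = g v + g w := by
  have hne : v ≠ w := by simpa using S.not_diag _ he
  have : (Finset.univ.filter fun u => u ∈ s(v, w)) = {v, w} := by
    ext u; simp
  rw [this, Finset.sum_pair hne]

theorem edgeWeight_mk {x : Sym2 V → ℝ} {v w : V} (he : s(v, w) ∈ S.E) :
    S.edgeWeight x s(v, w) =
      (xS x (S.succSet v s(v, w)) + xS x (S.simSet v s(v, w)) / 2) +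
      (xS x (S.succSet w s(v, w)) + xS x (S.simSet w s(v, w)) / 2) := by
  rw [edgeWeight, sum_ends he]
  simp only [sum_prefWeight]

theorem C2.swap {x : Sym2 V → ℝ} (h : S.C2 x) {v w : V} (he : s(v, w) ∈ S.E) :
    1 ≤ xS x (S.simSet w s(v, w)) +
      (xS x (S.succSet v s(v, w)) + xS x (S.succSet w s(v, w))) := by
  have := h w v (by rwa [Sym2.eq_swap])
  rw [Sym2.eq_swap] at this
  linarith

theorem one_le_edgeWeight {x : Sym2 V → ℝ} (h : S.C2 x) {e : Sym2 V} (he : e ∈ S.E) :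
    1 ≤ S.edgeWeight x e := by
  induction e with
  | _ v w =>
    rw [edgeWeight_mk he]
    linarith [h v w he, h.swap he]

theorem sum_edges_ends_comm (g : V → Sym2 V → ℝ) :
    ∑ e ∈ S.E, ∑ v with v ∈ e, g v e = ∑ v, ∑ e ∈ inc S.E v, g v e := by
  simp only [inc, Finset.sum_filter]
  exact Finset.sum_comm

theorem sum_xS_inc (x : Sym2 V → ℝ) : ∑ v, xS x (inc S.E v) = ∑ e ∈ S.E, 2 * x e := by
  simp only [xS]
  rw [← sum_edges_ends_comm]
  refine Finset.sum_congr rfl fun e he => ?_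
  induction e with
  | _ v w => rw [sum_ends he]; ring

theorem sum_mul_edgeWeight (x y : Sym2 V → ℝ) :
    ∑ e ∈ S.E, y e * S.edgeWeight x e =
      ∑ v, ∑ e ∈ inc S.E v, ∑ f ∈ inc S.E v, x f * y e * S.prefWeight v f e := by
  rw [← sum_edges_ends_comm]
  refine Finset.sum_congr rfl fun e _ => ?_
  simp only [edgeWeight, Finset.mul_sum]
  exact Finset.sum_congr rfl fun v _ => Finset.sum_congr rfl fun f _ => by ring

theorem sum_mul_edgeWeight_add_swap (x y : Sym2 V → ℝ) :
    ∑ e ∈ S.E, y e * S.edgeWeight x e + ∑ e ∈ S.E, x e * S.edgeWeight y e =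
      ∑ v, xS x (inc S.E v) * xS y (inc S.E v) := by
  rw [sum_mul_edgeWeight, sum_mul_edgeWeight, ← Finset.sum_add_distrib]
  refine Finset.sum_congr rfl fun v _ => ?_
  rw [xS, xS, Finset.sum_mul_sum, Finset.sum_comm, ← Finset.sum_add_distrib]
  refine Finset.sum_congr rfl fun f hf => ?_
  rw [← Finset.sum_add_distrib]
  refine Finset.sum_congr rfl fun e he => ?_
  linear_combination x f * y e * prefWeight_add_swap he hf

theorem xS_nonneg {x : Sym2 V → ℝ} (hx : S.IsVec x) (W : Finset (Sym2 V)) : 0 ≤ xS x W :=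
  Finset.sum_nonneg fun e _ => hx.1 e

/-- Complementary slackness: the double-counting inequalities are all tight on `P`. -/
theorem slackness {x y : Sym2 V → ℝ} (hx : S.memP x) (hy : S.memP y) :
    (∀ v, xS x (inc S.E v) * xS y (inc S.E v) =
      (xS x (inc S.E v) + xS y (inc S.E v)) / 2) ∧
    ∀ e ∈ S.E, y e * S.edgeWeight x e = y e := by
  have key : ∀ {x y : Sym2 V → ℝ}, S.memP x → S.memP y → ∀ e ∈ S.E,
      y e ≤ y e * S.edgeWeight x e := fun hx hy e he =>
    le_mul_of_one_le_right (hy.1.1 e) (one_le_edgeWeight hx.2.2.1 he)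
  have h₁ := Finset.sum_le_sum (key hx hy)
  have h₂ := Finset.sum_le_sum (key hy hx)
  have h₃ : ∀ v ∈ Finset.univ, xS x (inc S.E v) * xS y (inc S.E v) ≤
      (xS x (inc S.E v) + xS y (inc S.E v)) / 2 := fun v _ => by
    nlinarith [xS_nonneg hx.1 (inc S.E v), xS_nonneg hy.1 (inc S.E v), hx.2.1 v, hy.2.1 v]
  have h₄ := Finset.sum_le_sum h₃
  have h₅ : ∑ v, (xS x (inc S.E v) + xS y (inc S.E v)) / 2 =
      ∑ e ∈ S.E, x e + ∑ e ∈ S.E, y e := by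
    rw [← Finset.sum_div, Finset.sum_add_distrib, sum_xS_inc, sum_xS_inc, ← Finset.mul_sum,
      ← Finset.mul_sum]
    ring
  have h₆ := sum_mul_edgeWeight_add_swap (S := S) x y
  constructor
  · exact fun v => (Finset.sum_eq_sum_iff_of_le h₃).1 (by linarith) v (Finset.mem_univ v)
  · exact fun e he => ((Finset.sum_eq_sum_iff_of_le (key hx hy)).1 (by linarith) e he).symm

theorem xS_inc_eq_one {x : Sym2 V → ℝ} (hx : S.memP x) {e : Sym2 V} (he : e ∈ S.Eplus)
    {v : V} (hv : v ∈ e) : xS x (inc S.E v) = 1 := by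
  obtain ⟨heE, y, hy, hye⟩ := mem_Eplus.1 he
  have hpos : 0 < xS y (inc S.E v) :=
    hye.trans_le (Finset.single_le_sum (fun f _ => hy.1.1 f) (mem_inc.2 ⟨heE, hv⟩))
  have h := (slackness hx hy).1 v
  have h₁ := hx.2.1 v
  have h₂ := hy.2.1 v
  have h₃ := xS_nonneg hx.1 (inc S.E v)
  nlinarith

theorem edgeWeight_eq_one {x : Sym2 V → ℝ} (hx : S.memP x) {e : Sym2 V} (he : e ∈ S.Eplus) :
    S.edgeWeight x e = 1 := by
  obtain ⟨heE, y, hy, hye⟩ := mem_Eplus.1 he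
  exact (mul_eq_left₀ hye.ne').1 ((slackness hx hy).2 e heE)

theorem C2_tight {x : Sym2 V → ℝ} (hx : S.memP x) {v w : V} (he : s(v, w) ∈ S.Eplus) :
    xS x (S.simSet v s(v, w)) +
      (xS x (S.succSet v s(v, w)) + xS x (S.succSet w s(v, w))) = 1 ∧
    xS x (S.simSet w s(v, w)) = xS x (S.simSet v s(v, w)) := by
  have heE : s(v, w) ∈ S.E := (mem_Eplus.1 he).1
  have h := edgeWeight_eq_one hx he
  rw [edgeWeight_mk heE] at h
  have h₁ := hx.2.2.1 v w heE
  have h₂ := hx.2.2.1.swap heE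
  constructor <;> linarith

theorem xS_pos_iff {x : Sym2 V → ℝ} (hx : S.IsVec x) (W : Finset (Sym2 V)) :
    0 < xS x W ↔ ∃ e ∈ W, 0 < x e :=
  Finset.sum_pos_iff_of_nonneg fun e _ => hx.1 e

theorem inc_supp_nonempty {x : Sym2 V → ℝ} (hx : S.IsVec x) {v : V}
    (hv : 0 < xS x (inc S.E v)) : (inc (S.supp x) v).Nonempty := by
  obtain ⟨f, hf, hfx⟩ := (xS_pos_iff hx _).1 hv
  exact ⟨f, mem_inc_supp.2 ⟨hf, hfx⟩⟩

theorem Wset_nonempty {x : Sym2 V → ℝ} (hx : S.IsVec x) {v : V}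
    (hv : 0 < xS x (inc S.E v)) : (S.Wset x v).Nonempty := by
  obtain ⟨m, hm, h⟩ := exists_forall_rel_of_total
    (fun e f => S.pref v (some f) (some e)) _ (inc_supp_nonempty hx hv)
    (fun a ha b hb => pref_total_of_mem (mem_inc_supp.1 hb).1 (mem_inc_supp.1 ha).1)
    (fun a ha b hb c hc hab hbc => pref_trans_of_mem (mem_inc_supp.1 hc).1
      (mem_inc_supp.1 hb).1 (mem_inc_supp.1 ha).1 hbc hab)
  exact ⟨m, mem_Wset.2 ⟨hm, h⟩⟩

theorem Bset_nonempty {x : Sym2 V → ℝ} (hx : S.IsVec x) {v : V}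
    (hv : 0 < xS x (inc S.E v)) : (S.Bset x v).Nonempty := by
  obtain ⟨m, hm, h⟩ := exists_forall_rel_of_total
    (fun e f => S.pref v (some e) (some f)) _ (inc_supp_nonempty hx hv)
    (fun a ha b hb => pref_total_of_mem (mem_inc_supp.1 ha).1 (mem_inc_supp.1 hb).1)
    (fun a ha b hb c hc => pref_trans_of_mem (mem_inc_supp.1 ha).1
      (mem_inc_supp.1 hb).1 (mem_inc_supp.1 hc).1)
  exact ⟨m, mem_Bset.2 ⟨hm, h⟩⟩

theorem mem_simSet {v : V} {e f : Sym2 V} :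
    f ∈ S.simSet v e ↔ f ∈ inc S.E v ∧ S.IPref v (some f) (some e) := by
  simp [simSet]

theorem mem_succSet {v : V} {e f : Sym2 V} :
    f ∈ S.succSet v e ↔ f ∈ inc S.E v ∧ S.SPref v (some f) (some e) := by
  simp [succSet]

theorem xS_sim_add_succ_eq_iff {x : Sym2 V → ℝ} (hx : S.IsVec x) {v : V} {e : Sym2 V} :
    xS x (S.simSet v e) + xS x (S.succSet v e) = xS x (inc S.E v) ↔
      ∀ f ∈ inc (S.supp x) v, S.pref v (some f) (some e) := by
  classical
  have h : xS x (S.simSet v e) + xS x (S.succSet v e) =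
      ∑ f ∈ inc S.E v, if S.pref v (some f) (some e) then x f else 0 := by
    simp only [xS, succSet, simSet, Finset.sum_filter, ← Finset.sum_add_distrib]
    refine Finset.sum_congr rfl fun f _ => ?_
    by_cases h₁ : S.pref v (some e) (some f) <;> by_cases h₂ : S.pref v (some f) (some e) <;>
      simp [SPref, IPref, h₁, h₂]
  rw [h, xS, Finset.sum_eq_sum_iff_of_le fun f _ => by split_ifs <;> simp [hx.1 f]]
  refine ⟨fun H f hf => ?_, fun H f hf => ?_⟩
  · obtain ⟨hf, hfx⟩ := mem_inc_supp.1 hf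
    by_contra hn
    have := H f hf
    rw [if_neg hn] at this
    exact hfx.ne this
  · rcases (hx.1 f).eq_or_lt with h0 | h0
    · simp [← h0]
    · rw [if_pos (H f (mem_inc_supp.2 ⟨hf, h0⟩))]

theorem xS_succ_eq_zero_iff {x : Sym2 V → ℝ} (hx : S.IsVec x) {v : V} {e : Sym2 V}
    (he : e ∈ inc S.E v) :
    xS x (S.succSet v e) = 0 ↔ ∀ f ∈ inc (S.supp x) v, S.pref v (some e) (some f) := by
  rw [xS, Finset.sum_eq_zero_iff_of_nonneg fun f _ => hx.1 f]
  refine ⟨fun H f hf => ?_, fun H f hf => ?_⟩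
  · obtain ⟨hf, hfx⟩ := mem_inc_supp.1 hf
    by_contra hn
    exact hfx.ne' (H f (mem_succSet.2 ⟨hf, (pref_total_of_mem he hf).resolve_left hn, hn⟩))
  · obtain ⟨hf, hfe⟩ := mem_succSet.1 hf
    by_contra hn
    exact hfe.2 (H f (mem_inc_supp.2 ⟨hf, (hx.1 f).lt_of_ne' hn⟩))

theorem Wset_sim_iff {x : Sym2 V → ℝ} (hx : S.IsVec x) {v : V} {e : Sym2 V}
    (he : e ∈ inc S.E v) (hv : 0 < xS x (inc S.E v)) :
    (∀ f ∈ S.Wset x v, S.IPref v (some f) (some e)) ↔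
      0 < xS x (S.simSet v e) ∧
        xS x (S.simSet v e) + xS x (S.succSet v e) = xS x (inc S.E v) := by
  rw [xS_sim_add_succ_eq_iff hx, xS_pos_iff hx]
  constructor
  · intro H
    obtain ⟨m, hm⟩ := Wset_nonempty hx hv
    have hme := H m hm
    obtain ⟨hm, hmin⟩ := mem_Wset.1 hm
    obtain ⟨hmE, hmx⟩ := mem_inc_supp.1 hm
    exact ⟨⟨m, mem_simSet.2 ⟨hmE, hme⟩, hmx⟩, fun f hf =>
      pref_trans_of_mem (mem_inc_supp.1 hf).1 hmE he (hmin f hf) hme.1⟩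
  · rintro ⟨⟨g, hg, hgx⟩, H⟩ f hf
    obtain ⟨hf, hmin⟩ := mem_Wset.1 hf
    obtain ⟨hgE, hge⟩ := mem_simSet.1 hg
    exact ⟨H f hf, pref_trans_of_mem he hgE (mem_inc_supp.1 hf).1 hge.2
      (hmin g (mem_inc_supp.2 ⟨hgE, hgx⟩))⟩

theorem Bset_sim_iff {x : Sym2 V → ℝ} (hx : S.IsVec x) {v : V} {e : Sym2 V}
    (he : e ∈ inc S.E v) (hv : 0 < xS x (inc S.E v)) :
    (∀ f ∈ S.Bset x v, S.IPref v (some f) (some e)) ↔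
      0 < xS x (S.simSet v e) ∧ xS x (S.succSet v e) = 0 := by
  rw [xS_succ_eq_zero_iff hx he, xS_pos_iff hx]
  constructor
  · intro H
    obtain ⟨m, hm⟩ := Bset_nonempty hx hv
    have hme := H m hm
    obtain ⟨hm, hmax⟩ := mem_Bset.1 hm
    obtain ⟨hmE, hmx⟩ := mem_inc_supp.1 hm
    exact ⟨⟨m, mem_simSet.2 ⟨hmE, hme⟩, hmx⟩, fun f hf =>
      pref_trans_of_mem he hmE (mem_inc_supp.1 hf).1 hme.2 (hmax f hf)⟩
  · rintro ⟨⟨g, hg, hgx⟩, H⟩ f hf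
    obtain ⟨hf, hmax⟩ := mem_Bset.1 hf
    obtain ⟨hgE, hge⟩ := mem_simSet.1 hg
    exact ⟨pref_trans_of_mem (mem_inc_supp.1 hf).1 hgE he
      (hmax g (mem_inc_supp.2 ⟨hgE, hgx⟩)) hge.1, H f hf⟩

end RSetup

open RSetup in
/-- (A2) of Lemma 9: for `x ∈ P` and an edge
`e = {v, w} ∈ E⁺`, `W_x(v) ∼ᵥ e` iff `B_x(w) ∼_w e`. -/
theorem Wset_sim_iff_Bset_sim
    {V : Type*} [Fintype V] [DecidableEq V] (S : RSetup V)
    (hP : ∃ y : Sym2 V → ℝ, S.memP y)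
    (x : Sym2 V → ℝ) (hx : S.memP x)
    (v w : V) (he : s(v, w) ∈ S.Eplus) :
    (∀ f ∈ S.Wset x v, S.IPref v (some f) (some s(v, w))) ↔
      (∀ g ∈ S.Bset x w, S.IPref w (some g) (some s(v, w))) := by
  have heE : s(v, w) ∈ S.E := (mem_Eplus.1 he).1
  have hv := xS_inc_eq_one hx he (Sym2.mem_mk_left v w)
  have hw := xS_inc_eq_one hx he (Sym2.mem_mk_right v w)
  obtain ⟨h₁, h₂⟩ := C2_tight hx he
  rw [Wset_sim_iff hx.1 (mem_inc.2 ⟨heE, Sym2.mem_mk_left v w⟩) (by rw [hv]; exact one_pos),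
    Bset_sim_iff hx.1 (mem_inc.2 ⟨heE, Sym2.mem_mk_right v w⟩) (by rw [hw]; exact one_pos),
    h₂, hv]
  exact and_congr_right fun _ => ⟨fun h => by linarith, fun h => by linarith⟩
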